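/- Let n ≥ 1, let a ∈ S^{{n}}, and let A = {a_1, …, a_n} ⊆ S. Let G[a] = {g ∈ G | g(A) = A} be the setwise stabilizer of A and G(a) = {g ∈ G | g(a_i) = a_i for all i} the pointwise stabilizer. Then G(a) is a normal subgroup of G[a], the quotient G[a]/G(a) is cyclic of order n (isomorphic to ZMod n), and the quotient map splits: there exists τ ∈ G[a] of order n with τ(a_i) = a_{i−1} for all i (indices mod n). -/

import Mathlib

/-- The circle `S = ℝ/ℤ`. -/
abbrev Circle' : Type := AddCircle (1 : ℝ)

/-- `y` lies strictly between `x` and `z` in the cyclic order on the circle: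
there are lifts `x̃ < ỹ < z̃ < x̃ + 1`. -/
def Sbtw' (x y z : Circle') : Prop :=
  ∃ a b c : ℝ, (a : Circle') = x ∧ (b : Circle') = y ∧ (c : Circle') = z ∧
    a < b ∧ b < c ∧ c < a + 1

/-- A bijection of the circle preserves the cyclic order. -/
def PreservesCyclicOrder (g : Equiv.Perm Circle') : Prop :=
  ∀ x y z : Circle', Sbtw' x y z ↔ Sbtw' (g x) (g y) (g z)

/-- Membership in `S^{{n}}`: the tuple admits lifts `t 0 < t 1 < ⋯ < t (n-1) < t 0 + 1`. -/
def CyclicallyOrdered {n : ℕ} (x : Fin n → Circle') : Prop :=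
  ∃ t : Fin n → ℝ, (∀ i, (t i : Circle') = x i) ∧ StrictMono t ∧ ∀ i j, t i < t j + 1

/-- The pointwise stabilizer `G(a)`: cyclic-order-preserving bijections fixing
each entry of `a`. -/
def PointwiseStab {n : ℕ} (a : Fin n → Circle') : Subgroup (Equiv.Perm Circle') where
  carrier := {g | PreservesCyclicOrder g ∧ ∀ i, g (a i) = a i}
  one_mem' := ⟨fun _ _ _ => Iff.rfl, fun _ => rfl⟩
  mul_mem' := by
    rintro g h ⟨hg, hg'⟩ ⟨hh, hh'⟩
    refine ⟨fun x y z => (hh x y z).trans (hg (h x) (h y) (h z)), fun i => ?_⟩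
    simp [Equiv.Perm.mul_apply, hh' i, hg' i]
  inv_mem' := by
    rintro g ⟨hg, hg'⟩
    refine ⟨fun x y z => ?_, fun i => ?_⟩
    · simpa using (hg (g⁻¹ x) (g⁻¹ y) (g⁻¹ z)).symm
    · conv_lhs => rw [← hg' i]
      simp

/-- The setwise stabilizer `G[a]`: cyclic-order-preserving bijections carrying the
set `A = {a 0, …, a (n-1)}` onto itself. -/
def SetwiseStab {n : ℕ} (a : Fin n → Circle') : Subgroup (Equiv.Perm Circle') where
  carrier := {g | PreservesCyclicOrder g ∧ g '' Set.range a = Set.range a}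
  one_mem' := by
    refine ⟨fun _ _ _ => Iff.rfl, ?_⟩
    simp [Set.image_id']
  mul_mem' := by
    rintro g h ⟨hg, hg'⟩ ⟨hh, hh'⟩
    refine ⟨fun x y z => (hh x y z).trans (hg (h x) (h y) (h z)), ?_⟩
    have : (⇑(g * h)) '' Set.range a = g '' (h '' Set.range a) := by
      rw [← Set.image_comp]; rfl
    rw [this, hh', hg']
  inv_mem' := by
    rintro g ⟨hg, hg'⟩
    refine ⟨fun x y z => by simpa using (hg (g⁻¹ x) (g⁻¹ y) (g⁻¹ z)).symm, ?_⟩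
    conv_lhs => rw [← hg']
    rw [← Set.image_comp]
    simp

/-- The bijection of the circle induced by an increasing bijection of `ℝ` which commutes with
translation by `1`. -/
noncomputable def circlePermOfLift (σ : ℝ ≃o ℝ) (hσ : ∀ x, σ (x + 1) = σ x + 1) :
    Equiv.Perm Circle' :=
  have hσ' : ∀ x, σ.symm (x + 1) = σ.symm x + 1 := fun x => by
    rw [OrderIso.symm_apply_eq, hσ, OrderIso.apply_symm_apply]
  have h (ρ : ℝ ≃o ℝ) (hρ : ∀ x, ρ (x + 1) = ρ x + 1) :
      Function.Periodic (fun x => ((ρ x : ℝ) : Circle')) 1 := fun x => by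
    simp only [hρ, AddCircle.coe_add_period]
  { toFun := (h σ hσ).lift
    invFun := (h σ.symm hσ').lift
    left_inv := fun x => by
      induction x using QuotientAddGroup.induction_on
      simp [Function.Periodic.lift_coe]
    right_inv := fun x => by
      induction x using QuotientAddGroup.induction_on
      simp [Function.Periodic.lift_coe] }

theorem circlePermOfLift_coe (σ : ℝ ≃o ℝ) (hσ : ∀ x, σ (x + 1) = σ x + 1) (x : ℝ) :
    circlePermOfLift σ hσ (x : Circle') = (σ x : ℝ) := rfl

theorem circlePermOfLift_symm_coe (σ : ℝ ≃o ℝ) (hσ : ∀ x, σ (x + 1) = σ x + 1) (x : ℝ) :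
    (circlePermOfLift σ hσ).symm (x : Circle') = (σ.symm x : ℝ) := rfl

theorem preservesCyclicOrder_circlePermOfLift (σ : ℝ ≃o ℝ) (hσ : ∀ x, σ (x + 1) = σ x + 1) :
    PreservesCyclicOrder (circlePermOfLift σ hσ) := by
  intro x y z
  constructor
  · rintro ⟨u, v, w, rfl, rfl, rfl, huv, hvw, hwu⟩
    refine ⟨σ u, σ v, σ w, rfl, rfl, rfl, σ.strictMono huv, σ.strictMono hvw, ?_⟩
    rw [← hσ]
    exact σ.strictMono hwu
  · rintro ⟨u, v, w, hu, hv, hw, huv, hvw, hwu⟩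
    refine ⟨σ.symm u, σ.symm v, σ.symm w, ?_, ?_, ?_, σ.symm.strictMono huv,
      σ.symm.strictMono hvw, ?_⟩
    · rw [← circlePermOfLift_symm_coe σ hσ, hu, Equiv.symm_apply_apply]
    · rw [← circlePermOfLift_symm_coe σ hσ, hv, Equiv.symm_apply_apply]
    · rw [← circlePermOfLift_symm_coe σ hσ, hw, Equiv.symm_apply_apply]
    · rw [← σ.lt_iff_lt, hσ, σ.apply_symm_apply, σ.apply_symm_apply]
      exact hwu

theorem coe_eq_coe_iff_exists_int {x y : ℝ} :
    (x : Circle') = y ↔ ∃ m : ℤ, x = y + m := by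
  rw [← sub_eq_zero, ← AddCircle.coe_sub, AddCircle.coe_eq_zero_iff]
  refine exists_congr fun m => ?_
  rw [zsmul_one, eq_comm, sub_eq_iff_eq_add']

theorem coe_add_intCast (x : ℝ) (m : ℤ) : ((x + m : ℝ) : Circle') = x :=
  coe_eq_coe_iff_exists_int.2 ⟨m, rfl⟩

/-- The piecewise affine extension to `ℝ` of a function on `ℤ`. -/
noncomputable def piecewiseAffine (T : ℤ → ℝ) (y : ℝ) : ℝ :=
  T ⌊y⌋ + Int.fract y * (T (⌊y⌋ + 1) - T ⌊y⌋)

theorem piecewiseAffine_intCast (T : ℤ → ℝ) (k : ℤ) : piecewiseAffine T k = T k := by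
  simp [piecewiseAffine]

theorem strictMono_piecewiseAffine {T : ℤ → ℝ} (hT : StrictMono T) :
    StrictMono (piecewiseAffine T) := by
  intro x y hxy
  have hx : 0 < T (⌊x⌋ + 1) - T ⌊x⌋ := sub_pos.2 (hT (lt_add_one _))
  have hy : 0 < T (⌊y⌋ + 1) - T ⌊y⌋ := sub_pos.2 (hT (lt_add_one _))
  unfold piecewiseAffine
  rcases (Int.floor_mono hxy.le).eq_or_lt with h | h
  · have hf : Int.fract x < Int.fract y := by
      rw [Int.fract, Int.fract, h]
      linarith
    rw [h]
    gcongr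
  · have h₁ : T (⌊x⌋ + 1) ≤ T ⌊y⌋ := hT.monotone h
    have h₂ := mul_lt_mul_of_pos_right (Int.fract_lt_one x) hx
    have h₃ := mul_nonneg (Int.fract_nonneg y) hy.le
    linarith

theorem surjective_piecewiseAffine {T : ℤ → ℝ} (hT : StrictMono T)
    (hbelow : ∀ y, ∃ k, T k ≤ y) (habove : ∀ y, ∃ k, y < T k) :
    Function.Surjective (piecewiseAffine T) := by
  intro y
  obtain ⟨b, hb⟩ := habove y
  obtain ⟨k, hk, hmax⟩ := Int.exists_greatest_of_bdd (P := fun k => T k ≤ y)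
    ⟨b, fun k hk => (hT.lt_iff_lt.1 (hk.trans_lt hb)).le⟩ (hbelow y)
  have hk' : y < T (k + 1) := by
    by_contra! h
    have := hmax _ h
    omega
  have hpos : 0 < T (k + 1) - T k := by linarith
  have h₀ : 0 ≤ (y - T k) / (T (k + 1) - T k) := div_nonneg (by linarith) hpos.le
  have h₁ : (y - T k) / (T (k + 1) - T k) < 1 := by
    rw [div_lt_one hpos]
    linarith
  have hfl : ⌊(k : ℝ) + (y - T k) / (T (k + 1) - T k)⌋ = k := by
    rw [Int.floor_eq_iff]
    constructor <;> linarith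
  refine ⟨k + (y - T k) / (T (k + 1) - T k), ?_⟩
  rw [piecewiseAffine, Int.fract, hfl, add_sub_cancel_left, div_mul_cancel₀ _ hpos.ne']
  ring

theorem piecewiseAffine_add_natCast {T : ℤ → ℝ} {n : ℕ} (hT : ∀ k, T (k + n) = T k + 1)
    (y : ℝ) : piecewiseAffine T (y + n) = piecewiseAffine T y + 1 := by
  have h : T (⌊y⌋ + n + 1) = T (⌊y⌋ + 1) + 1 := by rw [← hT]; congr 1; ring
  rw [piecewiseAffine, piecewiseAffine, Int.floor_add_natCast, Int.fract_add_natCast, h, hT]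
  ring

theorem apply_add_mul_of_apply_add {T : ℤ → ℝ} {n : ℕ} (hT : ∀ k, T (k + n) = T k + 1)
    (k m : ℤ) : T (k + n * m) = T k + m := by
  induction m using Int.induction_on with
  | zero => simp
  | succ m ih =>
    rw [show k + n * ((m : ℤ) + 1) = k + n * m + n by ring, hT, ih]
    push_cast
    ring
  | pred m ih =>
    have h := hT (k + n * (-(m : ℤ) - 1))
    rw [show k + n * (-(m : ℤ) - 1) + n = k + n * -(m : ℤ) by ring, ih] at h
    push_cast at h ⊢
    linarith

theorem coe_apply_eq_coe_apply_iff {T : ℤ → ℝ} {n : ℕ} (hmono : StrictMono T)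
    (hT : ∀ k, T (k + n) = T k + 1) {j k : ℤ} :
    (T j : Circle') = T k ↔ (n : ℤ) ∣ j - k := by
  rw [coe_eq_coe_iff_exists_int]
  refine exists_congr fun m => ?_
  rw [← apply_add_mul_of_apply_add hT, hmono.injective.eq_iff, sub_eq_iff_eq_add']

/-- The shift of a bi-infinite sequence of lifts extends to an order-preserving bijection of the
circle whose `n`-th power is trivial. -/
theorem exists_preservesCyclicOrder_shift {T : ℤ → ℝ} {n : ℕ} (hmono : StrictMono T)
    (hT : ∀ k, T (k + n) = T k + 1) :
    ∃ τ : Equiv.Perm Circle', PreservesCyclicOrder τ ∧ τ ^ n = 1 ∧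
      ∀ k : ℤ, τ (T k : Circle') = (T (k - 1) : ℝ) := by
  have hsurj : Function.Surjective (piecewiseAffine T) := by
    refine surjective_piecewiseAffine hmono (fun y => ⟨0 + n * ⌊y - T 0⌋, ?_⟩)
      (fun y => ⟨0 + n * (⌊y - T 0⌋ + 1), ?_⟩)
    · rw [apply_add_mul_of_apply_add hT]
      linarith [Int.floor_le (y - T 0)]
    · rw [apply_add_mul_of_apply_add hT]
      push_cast
      linarith [Int.lt_floor_add_one (y - T 0)]
  let F : ℝ ≃o ℝ := (strictMono_piecewiseAffine hmono).orderIsoOfSurjective _ hsurj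
  have hF (y : ℝ) : F (y + n) = F y + 1 := piecewiseAffine_add_natCast hT y
  have hFT (k : ℤ) : F k = T k := piecewiseAffine_intCast T k
  have hF' (x : ℝ) : F.symm (x + 1) = F.symm x + n := by
    rw [OrderIso.symm_apply_eq, hF, OrderIso.apply_symm_apply]
  let σ : ℝ ≃o ℝ := (F.symm.trans (OrderIso.subRight 1)).trans F
  have hσ (x : ℝ) : σ x = F (F.symm x - 1) := rfl
  have hσ1 (x : ℝ) : σ (x + 1) = σ x + 1 := by
    rw [hσ, hσ, hF', ← hF]
    congr 1
    ring
  refine ⟨circlePermOfLift σ hσ1, preservesCyclicOrder_circlePermOfLift σ hσ1, ?_, fun k => ?_⟩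
  · have hpow (m : ℕ) (y : ℝ) :
        (circlePermOfLift σ hσ1 ^ m) (F y : Circle') = (F (y - m) : ℝ) := by
      induction m with
      | zero => simp
      | succ m ih =>
        rw [pow_succ', Equiv.Perm.mul_apply, ih, circlePermOfLift_coe, hσ, F.symm_apply_apply]
        push_cast
        rw [sub_sub]
    ext x
    induction x using QuotientAddGroup.induction_on with
    | H x =>
      obtain ⟨y, rfl⟩ := F.surjective x
      have h := hF (y - n)
      rw [sub_add_cancel] at h
      change (circlePermOfLift σ hσ1 ^ n) (F y : Circle') = (F y : ℝ)
      rw [hpow, h, AddCircle.coe_add_period]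
  · rw [circlePermOfLift_coe, hσ, ← hFT, F.symm_apply_apply, ← hFT]
    push_cast
    rfl

/-- The lifts of a cyclically ordered tuple extend to a bi-infinite increasing sequence of lifts
which advances by `1` every `n` steps. -/
theorem CyclicallyOrdered.exists_int_lift {n : ℕ} [NeZero n] {a : Fin n → Circle'}
    (ha : CyclicallyOrdered a) :
    ∃ T : ℤ → ℝ, StrictMono T ∧ (∀ k, T (k + n) = T k + 1) ∧
      ∀ i : Fin n, (T (i : ℕ) : Circle') = a i := by
  obtain ⟨t, hta, ht, ht1⟩ := ha
  have hn : (0 : ℤ) < n := by exact_mod_cast Nat.pos_of_neZero n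
  have hlt (k : ℤ) : (k % n).toNat < n := by
    have := Int.emod_nonneg k hn.ne'
    have := Int.emod_lt_of_pos k hn
    omega
  refine ⟨fun k => t ⟨(k % n).toNat, hlt k⟩ + (k / n : ℤ), fun j k hjk => ?_, fun k => ?_,
    fun i => ?_⟩
  · have hj := Int.emod_add_mul_ediv j n
    have hk := Int.emod_add_mul_ediv k n
    have hj0 := Int.emod_nonneg j hn.ne'
    have hk0 := Int.emod_nonneg k hn.ne'
    rcases (Int.ediv_le_ediv hn hjk.le).eq_or_lt with h | h
    · simp only [h]
      rw [h] at hj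
      gcongr
      apply ht
      rw [Fin.mk_lt_mk]
      omega
    · have h' : ((j / n : ℤ) : ℝ) + 1 ≤ (k / n : ℤ) := by exact_mod_cast h
      have := ht1 ⟨(j % n).toNat, hlt j⟩ ⟨(k % n).toNat, hlt k⟩
      dsimp only
      linarith
  · simp [Int.add_ediv_of_dvd_right, add_assoc]
  · rw [coe_add_intCast, ← hta]
    congr 2
    ext
    have := i.isLt
    have := Int.emod_eq_of_lt (a := (i : ℕ)) (b := n) (by omega) (by omega)
    dsimp only
    omega

theorem CyclicallyOrdered.injective {n : ℕ} {a : Fin n → Circle'} (ha : CyclicallyOrdered a) :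
    Function.Injective a := by
  obtain ⟨t, hta, ht, ht1⟩ := ha
  intro i j hij
  rw [← hta, ← hta, coe_eq_coe_iff_exists_int] at hij
  obtain ⟨m, hm⟩ := hij
  have h₁ := ht1 i j
  have h₂ := ht1 j i
  have h₃ : (m : ℝ) < 1 := by linarith
  have h₄ : (-1 : ℝ) < m := by linarith
  have h₅ : m < 1 := by exact_mod_cast h₃
  have h₆ : -1 < m := by exact_mod_cast h₄
  obtain rfl : m = 0 := by omega
  exact ht.injective (by simpa using hm)

theorem CyclicallyOrdered.sbtw_zero_iff {n : ℕ} [NeZero n] {a : Fin n → Circle'}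
    (ha : CyclicallyOrdered a) {i j : Fin n} : Sbtw' (a 0) (a i) (a j) ↔ 0 < i ∧ i < j := by
  obtain ⟨t, hta, ht, ht1⟩ := ha
  constructor
  · rintro ⟨u, v, w, hu, hv, hw, huv, hvw, hwu⟩
    rw [← hta, coe_eq_coe_iff_exists_int] at hu hv hw
    obtain ⟨m, rfl⟩ := hu
    have key {k : Fin n} {x : ℝ} (hx : ∃ p : ℤ, x = t k + p) (h₁ : t 0 + m < x)
        (h₂ : x < t 0 + m + 1) : x = t k + m := by
      obtain ⟨p, rfl⟩ := hx
      have h₃ := ht.monotone (Fin.zero_le k)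
      have h₄ := ht1 k 0
      have h₅ : (p : ℝ) < m + 1 := by linarith
      have h₆ : (m : ℝ) < p + 1 := by linarith
      have h₇ : p < m + 1 := by exact_mod_cast h₅
      have h₈ : m < p + 1 := by exact_mod_cast h₆
      rw [show p = m by omega]
    have hv' := key hv huv (hvw.trans hwu)
    have hw' := key hw (huv.trans hvw) hwu
    exact ⟨ht.lt_iff_lt.1 (by linarith), ht.lt_iff_lt.1 (by linarith)⟩
  · rintro ⟨hi, hij⟩
    exact ⟨t 0, t i, t j, hta _, hta _, hta _, ht hi, ht hij, ht1 j 0⟩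

/-- An element of the setwise stabilizer fixing one entry of the tuple fixes all of them. -/
theorem mem_pointwiseStab_of_apply_zero {n : ℕ} [NeZero n] {a : Fin n → Circle'}
    (ha : CyclicallyOrdered a) {g : Equiv.Perm Circle'} (hg : g ∈ SetwiseStab a)
    (h0 : g (a 0) = a 0) : g ∈ PointwiseStab a := by
  obtain ⟨hord, himg⟩ := hg
  have hmem (i : Fin n) : ∃ j, a j = g (a i) := by
    rw [← Set.mem_range, ← himg]
    exact ⟨a i, ⟨i, rfl⟩, rfl⟩
  choose π hπ using hmem
  have hinj : Function.Injective π := fun i j hij =>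
    ha.injective (g.injective (by rw [← hπ, ← hπ, hij]))
  have hπ0 : π 0 = 0 := ha.injective (by rw [hπ, h0])
  have hmono : StrictMono π := by
    intro i j hij
    rcases eq_or_ne i 0 with rfl | hi
    · rw [hπ0, Fin.pos_iff_ne_zero, ← hπ0]
      exact hinj.ne hij.ne'
    · have h := (hord _ _ _).1 (ha.sbtw_zero_iff.2 ⟨Fin.pos_iff_ne_zero.2 hi, hij⟩)
      rw [h0, ← hπ, ← hπ] at h
      exact (ha.sbtw_zero_iff.1 h).2
  refine ⟨hord, fun i => ?_⟩
  rw [← hπ, hmono.eq_id, id]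

theorem normal_pointwiseStab_subgroupOf {n : ℕ} (a : Fin n → Circle') :
    ((PointwiseStab a).subgroupOf (SetwiseStab a)).Normal := by
  refine ⟨fun h hh g => ?_⟩
  rw [Subgroup.mem_subgroupOf] at hh ⊢
  refine ⟨(g * h * g⁻¹).2.1, fun i => ?_⟩
  obtain ⟨_, ⟨j, rfl⟩, hj⟩ : a i ∈ (g : Equiv.Perm Circle') '' Set.range a :=
    g.2.2.symm ▸ ⟨i, rfl⟩
  simp [← hj, hh.2 j]

/-- For `n ≥ 1` and `a ∈ S^{{n}}`: the pointwise stabilizer `G(a)` is a normal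
subgroup of the setwise stabilizer `G[a]`, the quotient `G[a]/G(a)` is cyclic of
order `n` (isomorphic to `ZMod n`), and the quotient map splits: there is a
`τ ∈ G[a]` of order `n` with `τ (a i) = a (i − 1)` for all `i`. -/
theorem setwiseStab_quotient_pointwiseStab
    (n : ℕ) [NeZero n] (a : Fin n → Circle') (ha : CyclicallyOrdered a) :
    ∃ _ : ((PointwiseStab a).subgroupOf (SetwiseStab a)).Normal,
      Nonempty ((SetwiseStab a ⧸ (PointwiseStab a).subgroupOf (SetwiseStab a)) ≃*
        Multiplicative (ZMod n)) ∧
      ∃ τ : Equiv.Perm Circle', τ ∈ SetwiseStab a ∧ orderOf τ = n ∧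
        ∀ i : Fin n, τ (a i) = a (i - 1) := by
  obtain ⟨T, hmono, hT, hTa⟩ := ha.exists_int_lift
  obtain ⟨τ, hord, hpow, hshift⟩ := exists_preservesCyclicOrder_shift hmono hT
  have hn : (0 : ℤ) < n := by exact_mod_cast Nat.pos_of_neZero n
  have hτ (i : Fin n) : τ (a i) = a (i - 1) := by
    rw [← hTa, hshift, ← hTa, coe_apply_eq_coe_apply_iff hmono hT, Fin.val_sub, Fin.val_one']
    have h1 := Nat.mod_le 1 n
    have h2 : 1 % n < n := Nat.mod_lt _ (Nat.pos_of_neZero n)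
    rw [← Int.modEq_iff_dvd]
    push_cast [h2.le]
    refine (Int.mod_modEq _ _).trans ?_
    calc (n : ℤ) - 1 % n + i ≡ 0 - 1 + i [ZMOD n] := by
          refine Int.ModEq.add (Int.ModEq.sub ?_ (Int.mod_modEq _ _)) rfl
          simp [Int.ModEq]
      _ = i - 1 := by ring
  have hiter (m : ℕ) : (τ ^ m) (a 0) = (T (-m) : ℝ) := by
    induction m with
    | zero => simp [← hTa]
    | succ m ih =>
      rw [pow_succ', Equiv.Perm.mul_apply, ih, hshift]
      push_cast
      rw [neg_add']
  have hiter_eq (m : ℕ) (i : Fin n) : (τ ^ m) (a 0) = a i ↔ n ∣ m + i := by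
    rw [hiter, ← hTa, coe_apply_eq_coe_apply_iff hmono hT, ← neg_add', dvd_neg]
    exact_mod_cast Iff.rfl
  have hset : τ ∈ SetwiseStab a := by
    refine ⟨hord, ?_⟩
    rw [← Set.range_comp, show τ ∘ a = a ∘ Equiv.subRight 1 from funext hτ,
      (Equiv.subRight (1 : Fin n)).surjective.range_comp]
  have hdvd {m : ℕ} (h : τ ^ m ∈ PointwiseStab a) : n ∣ m := by
    simpa using (hiter_eq m 0).1 (h.2 0)
  have hnormal := normal_pointwiseStab_subgroupOf a
  refine ⟨hnormal, ?_, τ, hset, ?_, hτ⟩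
  · let q : SetwiseStab a ⧸ (PointwiseStab a).subgroupOf (SetwiseStab a) :=
      QuotientGroup.mk ⟨τ, hset⟩
    have hq : orderOf q = n := by
      refine Nat.dvd_antisymm (orderOf_dvd_of_pow_eq_one ?_) ?_
      · have : (⟨τ, hset⟩ : SetwiseStab a) ^ n = 1 := Subtype.ext hpow
        rw [← QuotientGroup.mk_pow, this, QuotientGroup.mk_one]
      · have h := pow_orderOf_eq_one q
        rw [← QuotientGroup.mk_pow, QuotientGroup.eq_one_iff, Subgroup.mem_subgroupOf] at h
        exact hdvd h
    have hgen (x) : x ∈ Subgroup.zpowers q := by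
      induction x using QuotientGroup.induction_on with
      | H g =>
        obtain ⟨i, hi⟩ : g.1 (a 0) ∈ Set.range a :=
          g.2.2 ▸ Set.mem_image_of_mem _ (Set.mem_range_self 0)
        have hg : (τ ^ (n - i : ℕ)) (a 0) = g.1 (a 0) := by
          rw [← hi, hiter_eq, Nat.sub_add_cancel i.isLt.le]
        refine ⟨(n - i : ℕ), ?_⟩
        dsimp only
        rw [zpow_natCast, ← QuotientGroup.mk_pow, QuotientGroup.eq, Subgroup.mem_subgroupOf]
        refine mem_pointwiseStab_of_apply_zero ha (Subtype.prop _) ?_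
        simp [← hg]
    have hcyc : IsCyclic (SetwiseStab a ⧸ (PointwiseStab a).subgroupOf (SetwiseStab a)) :=
      ⟨q, hgen⟩
    refine ⟨mulEquivOfCyclicCardEq ?_⟩
    rw [← orderOf_eq_card_of_forall_mem_zpowers hgen, hq]
    simp
  · refine Nat.dvd_antisymm (orderOf_dvd_of_pow_eq_one hpow) (hdvd ?_)
    rw [pow_orderOf_eq_one]
    exact one_mem _
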